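/- arXiv:nlin/0312062 — 4 statements merged into one kernel-verified Lean document; each statement's English description precedes it below -/
import Mathlib

section
/- Let c : {0,…,N−1} × {0,…,N−1} → ℂ and define the diffusion superoperator D on N×N complex matrices by D(X) = Σ_{a,b=0}^{N−1} c(a,b) · T_{(a,b)} X T_{(a,b)}ᴴ. Then every torus translation operator is an eigenvector of D: for all integers μ, ν, D(T_{(μ,ν)}) = c̃(μ,ν) · T_{(μ,ν)}, where c̃(μ,ν) = Σ_{a,b=0}^{N−1} c(a,b) · exp(2πi (μ b − ν a)/N) is the two-dimensional discrete Fourier transform of the coefficients c. -/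
open Matrix

/-- The torus translation operator `T_{(a,b)}` on `ℂ^(ℤ/Nℤ)`, determined by
`T_{(a,b)}|q⟩ = exp(iπ b (2q̃ + a)/N) |q + a⟩`. -/
noncomputable def torusT (N : ℕ) (a b : ℤ) : Matrix (ZMod N) (ZMod N) ℂ :=
  Matrix.of fun r c =>
    if r = c + (a : ZMod N) then
      Complex.exp ((Real.pi : ℂ) * Complex.I * (b : ℂ) *
        ((2 * (c.val : ℤ) + a : ℤ) : ℂ) / (N : ℂ))
    else 0

/-- The phase defining `torusT` may be computed from any integer representative of the column. -/
theorem torusT_apply_intCast (N : ℕ) [NeZero N] (a b n : ℤ) (r : ZMod N) :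
    torusT N a b r (n : ZMod N) =
      if r = (n : ZMod N) + (a : ZMod N) then
        Complex.exp ((Real.pi : ℂ) * Complex.I * (b : ℂ) * ((2 * n + a : ℤ) : ℂ) / (N : ℂ))
      else 0 := by
  have hN : (N : ℂ) ≠ 0 := Nat.cast_ne_zero.mpr (NeZero.ne N)
  simp only [torusT, Matrix.of_apply]
  congr 1
  rw [Complex.exp_eq_exp_iff_exists_int, ZMod.val_intCast]
  refine ⟨-(b * (n / N)), ?_⟩
  have h : ((n % N : ℤ) : ℂ) = n - N * ((n / N : ℤ) : ℂ) := by
    rw [Int.emod_def]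
    push_cast
    ring
  push_cast [h]
  field_simp
  ring

theorem torusT_mulVec_single (N : ℕ) [NeZero N] (a b n : ℤ) :
    torusT N a b *ᵥ Pi.single (n : ZMod N) 1 =
      Complex.exp ((Real.pi : ℂ) * Complex.I * (b : ℂ) * ((2 * n + a : ℤ) : ℂ) / (N : ℂ)) •
        Pi.single ((n + a : ℤ) : ZMod N) 1 := by
  ext r
  simp [torusT_apply_intCast, Pi.single_apply]

theorem torusT_mul_comm (N : ℕ) [NeZero N] (a b μ ν : ℤ) :
    torusT N a b * torusT N μ ν =
      Complex.exp (2 * (Real.pi : ℂ) * Complex.I * ((μ * b - ν * a : ℤ) : ℂ) / (N : ℂ)) •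
        (torusT N μ ν * torusT N a b) := by
  refine Matrix.ext_of_mulVec_single fun q => ?_
  obtain ⟨n, rfl⟩ := ZMod.intCast_surjective q
  simp only [Matrix.smul_mulVec, ← Matrix.mulVec_mulVec, torusT_mulVec_single,
    Matrix.mulVec_smul, smul_smul, ← Complex.exp_add]
  rw [add_right_comm n a μ]
  congr 2
  push_cast
  ring

theorem torusT_mul_conjTranspose (N : ℕ) [NeZero N] (a b : ℤ) :
    torusT N a b * (torusT N a b)ᴴ = 1 := by
  rw [mul_eq_one_comm]
  ext r s
  rw [Matrix.mul_apply, Finset.sum_eq_single (s + (a : ZMod N))]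
  · by_cases h : r = s
    · subst h
      simp only [Matrix.conjTranspose_apply, torusT, Matrix.of_apply, if_true,
        Matrix.one_apply_eq, Complex.star_def, ← Complex.exp_conj, ← Complex.exp_add,
        map_div₀, map_mul, Complex.conj_ofReal, Complex.conj_I, map_intCast, map_natCast,
        mul_neg, neg_mul, neg_div, neg_add_cancel, Complex.exp_zero]
    · simp [torusT, Ne.symm h, h]
  · intro k _ hk
    simp [torusT, hk]
  · simp

/-- Every torus translation operator is an eigenvector of the diffusion
superoperator `D(X) = Σ_{a,b} c(a,b) T_{(a,b)} X T_{(a,b)}ᴴ`, with eigenvalue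
given by the two-dimensional discrete Fourier transform of the coefficients:
`D(T_{(μ,ν)}) = c̃(μ,ν) T_{(μ,ν)}` where
`c̃(μ,ν) = Σ_{a,b} c(a,b) exp(2πi (μb − νa)/N)`. -/
theorem diffusion_eigen_torusT (N : ℕ) [NeZero N] (c : Fin N → Fin N → ℂ) (μ ν : ℤ) :
    (∑ a : Fin N, ∑ b : Fin N,
        c a b • (torusT N (a : ℤ) (b : ℤ) * torusT N μ ν * (torusT N (a : ℤ) (b : ℤ))ᴴ)) =
      (∑ a : Fin N, ∑ b : Fin N,
          c a b * Complex.exp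
            (2 * (Real.pi : ℂ) * Complex.I * ((μ * (b : ℤ) - ν * (a : ℤ) : ℤ) : ℂ) / (N : ℂ))) •
        torusT N μ ν := by
  simp only [torusT_mul_comm N _ _ μ ν, Matrix.smul_mul, Matrix.mul_assoc,
    torusT_mul_conjTranspose, Matrix.mul_one, smul_smul, Finset.sum_smul]
end

section
/- Let A be an n×n complex matrix, and suppose there exist vectors r_0,…,r_{n−1} and l_0,…,l_{n−1} in ℂ^n and complex numbers λ_0,…,λ_{n−1} such that A r_i = λ_i r_i, Aᴴ l_i = conj(λ_i) l_i, and ⟨l_i, r_j⟩ = δ_{ij} for all i, j. Let u_0 ∈ ℂ^n and set α_i = ⟨l_i, u_0⟩ and β_i = ⟨r_i, u_0⟩. Then for all natural numbers μ, ν: ⟨(Aᴴ)^μ u_0, A^ν u_0⟩ = Σ_{i=0}^{n−1} conj(β_i) · α_i · λ_i^{μ+ν}. -/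
open Matrix

/-- A family `r` of `n` vectors with a biorthogonal dual family `l` spans: every vector `u` is
`∑ i, ⟨l i, u⟩ • r i`. -/
theorem sum_star_dotProduct_smul_of_biorthogonal {ι : Type*} [Fintype ι] [DecidableEq ι]
    {r l : ι → ι → ℂ} (horth : ∀ i j, star (l i) ⬝ᵥ r j = if i = j then 1 else 0) (u : ι → ℂ) :
    ∑ i, (star (l i) ⬝ᵥ u) • r i = u := by
  have hLR : (of fun i => star (l i)) * (of r)ᵀ = 1 := by
    ext i j
    exact (horth i j).trans (one_apply ..).symm
  have hRL := mul_eq_one_comm.mp hLR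
  calc ∑ i, (star (l i) ⬝ᵥ u) • r i
      = (of r)ᵀ *ᵥ ((of fun i => star (l i)) *ᵥ u) := by
        rw [mulVec_transpose, vecMul_eq_sum]
        rfl
    _ = u := by rw [mulVec_mulVec, hRL, one_mulVec]

/-- Powers of a matrix act on an eigenvector by powers of the eigenvalue. -/
theorem pow_mulVec_of_mulVec_eq_smul {ι : Type*} [Fintype ι] [DecidableEq ι]
    {A : Matrix ι ι ℂ} {v : ι → ℂ} {c : ℂ} (h : A *ᵥ v = c • v) (k : ℕ) :
    (A ^ k) *ᵥ v = c ^ k • v := by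
  induction k with
  | zero => simp
  | succ k ih => rw [pow_succ, ← mulVec_mulVec, h, mulVec_smul, ih, smul_smul, pow_succ']

/-- Given a biorthogonal system of right eigenvectors `r_i` and left
eigenvectors `l_i` of a matrix `A` (`⟨l_i, r_j⟩ = δ_{ij}`), with
`α_i = ⟨l_i, u₀⟩` and `β_i = ⟨r_i, u₀⟩`, the overlaps of the Krylov iterates
satisfy `⟨(Aᴴ)^μ u₀, A^ν u₀⟩ = Σ_i conj(β_i) α_i λ_i^{μ+ν}`. -/
theorem krylov_overlaps
    (n : ℕ) (A : Matrix (Fin n) (Fin n) ℂ)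
    (r l : Fin n → Fin n → ℂ) (lam : Fin n → ℂ)
    (hr : ∀ i, A.mulVec (r i) = lam i • r i)
    (hl : ∀ i, Aᴴ.mulVec (l i) = (starRingEnd ℂ (lam i)) • l i)
    (horth : ∀ i j, star (l i) ⬝ᵥ r j = if i = j then 1 else 0)
    (u₀ : Fin n → ℂ) (α β : Fin n → ℂ)
    (hα : ∀ i, α i = star (l i) ⬝ᵥ u₀) (hβ : ∀ i, β i = star (r i) ⬝ᵥ u₀) :
    ∀ μ ν : ℕ,
      star ((Aᴴ ^ μ).mulVec u₀) ⬝ᵥ ((A ^ ν).mulVec u₀) =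
        ∑ i, starRingEnd ℂ (β i) * α i * lam i ^ (μ + ν) := by
  intro μ ν
  have hadj : star ((Aᴴ ^ μ) *ᵥ u₀) ⬝ᵥ ((A ^ ν) *ᵥ u₀) = star u₀ ⬝ᵥ ((A ^ (μ + ν)) *ᵥ u₀) := by
    rw [star_mulVec, conjTranspose_pow, conjTranspose_conjTranspose, ← dotProduct_mulVec,
      mulVec_mulVec, pow_add]
  have hexp : (A ^ (μ + ν)) *ᵥ u₀ = ∑ i, α i • lam i ^ (μ + ν) • r i := by
    conv_lhs => rw [← sum_star_dotProduct_smul_of_biorthogonal horth u₀]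
    simp only [mulVec_sum, mulVec_smul, pow_mulVec_of_mulVec_eq_smul (hr _), hα]
  rw [hadj, hexp, dotProduct_sum]
  refine Finset.sum_congr rfl fun i _ => ?_
  have hconj : starRingEnd ℂ (β i) = star u₀ ⬝ᵥ r i := by
    rw [hβ, starRingEnd_apply, star_dotProduct, star_star]
  rw [hconj, dotProduct_smul, dotProduct_smul, smul_eq_mul, smul_eq_mul]
  ring
end

section
/- Let k be a natural number, λ_0,…,λ_{k−1} and c_0,…,c_{k−1} complex numbers, and z ∈ ℂ. Define the k×k complex matrix M by M_{μν} = Σ_{i=0}^{k−1} c_i · λ_i^{μ+ν} · (λ_i − z) for μ, ν ∈ {0,…,k−1}. Then det M = (∏_{0 ≤ i < j ≤ k−1} (λ_j − λ_i))² · ∏_{i=0}^{k−1} c_i (λ_i − z); i.e. the secular determinant factorizes into the square of the Vandermonde determinant of the λ_i times the product of the factors c_i(λ_i − z). -/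
open Matrix

/-- Factorization of the secular determinant: if
`M_{μν} = Σ_i c_i λ_i^{μ+ν} (λ_i − z)`, then
`det M = (∏_{i<j} (λ_j − λ_i))² · ∏_i c_i (λ_i − z)`. -/
theorem secular_determinant_factorization
    (k : ℕ) (lam c : Fin k → ℂ) (z : ℂ) :
    (Matrix.of fun μ ν : Fin k =>
        ∑ i, c i * lam i ^ ((μ : ℕ) + (ν : ℕ)) * (lam i - z)).det =
      (∏ i, ∏ j ∈ Finset.Ioi i, (lam j - lam i)) ^ 2 *
        ∏ i, c i * (lam i - z) := by
  have factorization : (Matrix.of fun μ ν : Fin k =>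
        ∑ i, c i * lam i ^ ((μ : ℕ) + (ν : ℕ)) * (lam i - z)) =
      (vandermonde lam)ᵀ * diagonal (fun i => c i * (lam i - z)) * vandermonde lam := by
    ext μ ν
    rw [Matrix.mul_apply, of_apply]
    refine Finset.sum_congr rfl fun i _ => ?_
    rw [mul_diagonal, transpose_apply, vandermonde_apply, vandermonde_apply]
    ring
  rw [factorization, det_mul, det_mul, det_transpose, det_diagonal, det_vandermonde]
  ring
end

section
/- Let A be an n×n complex matrix with pairwise distinct eigenvalues λ_0,…,λ_{n−1}, right eigenvectors A r_i = λ_i r_i, left eigenvectors Aᴴ l_i = conj(λ_i) l_i, normalized so that ⟨l_i, r_j⟩ = δ_{ij}. Let u_0 ∈ ℂ^n, α_i = ⟨l_i, u_0⟩, β_i = ⟨r_i, u_0⟩, and let K = [u_0 | A u_0 | … | A^{n−1} u_0] and K' = [u_0 | Aᴴ u_0 | … | (Aᴴ)^{n−1} u_0] be the n×n Krylov matrices whose columns are the iterates of u_0 under A and Aᴴ respectively. Then for every z ∈ ℂ: det(K'ᴴ A K − z · K'ᴴ K) = (∏_{i} conj(β_i) α_i) · (∏_{i<j} (λ_j − λ_i))²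 · ∏_{i} (λ_i − z). In particular, if α_i ≠ 0 and β_i ≠ 0 for all i, then the roots of the generalized eigenvalue equation det(K'ᴴ A K − z · K'ᴴ K) = 0 are exactly the eigenvalues λ_0,…,λ_{n−1} of A. -/
open Matrix

section Krylov

variable {R : Type*} [CommRing R] {n : ℕ}

theorem Matrix.vecMul_pow_of_vecMul_eq_smul {m : Type*} [Fintype m] [DecidableEq m]
    {A : Matrix m m R} {w : m → R} {μ : R} (h : w ᵥ* A = μ • w) (k : ℕ) :
    w ᵥ* (A ^ k) = μ ^ k • w := by
  induction k with
  | zero => simp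
  | succ k ih => rw [pow_succ, ← vecMul_vecMul, ih, smul_vecMul, h, smul_smul, pow_succ]

/-- A matrix of left eigenvectors times a Krylov matrix is a diagonal matrix times a
Vandermonde matrix; this is the resulting identity of determinants. -/
theorem Matrix.det_leftEigenvectors_mul_det_krylov {A W : Matrix (Fin n) (Fin n) R}
    {μ : Fin n → R} (h : ∀ i, W i ᵥ* A = μ i • W i) (u : Fin n → R) :
    W.det * (of fun i j : Fin n => ((A ^ (j : ℕ)) *ᵥ u) i).det =
      (∏ i, W i ⬝ᵥ u) * (vandermonde μ).det := by
  rw [← det_mul, ← det_diagonal, ← det_mul]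
  congr 1
  ext i j
  have : (W * of fun i j : Fin n => ((A ^ (j : ℕ)) *ᵥ u) i) i j =
      W i ⬝ᵥ ((A ^ (j : ℕ)) *ᵥ u) := rfl
  rw [this, dotProduct_mulVec, vecMul_pow_of_vecMul_eq_smul (h i), smul_dotProduct,
    diagonal_mul, vandermonde_apply, smul_eq_mul, mul_comm]

/-- If `W` has an inverse `V` and its rows are left eigenvectors of `A` for the values `μ`, then
the characteristic determinant of `A` splits over `μ`. -/
theorem Matrix.det_sub_smul_one_of_leftEigenvectors {A W V : Matrix (Fin n) (Fin n) R}
    {μ : Fin n → R} (h : ∀ i, W i ᵥ* A = μ i • W i) (hWV : W * V = 1) (z : R) :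
    (A - z • (1 : Matrix (Fin n) (Fin n) R)).det = ∏ i, (μ i - z) := by
  have hWA : W * A = diagonal μ * W := by
    ext i j
    rw [diagonal_mul]
    exact congrFun (h i) j
  have hconj : W * (A - z • (1 : Matrix (Fin n) (Fin n) R)) * V =
      diagonal fun i => μ i - z := by
    rw [mul_sub, hWA, sub_mul, Matrix.mul_assoc, hWV, Matrix.mul_smul, Matrix.mul_one,
      Matrix.mul_one, Matrix.smul_mul, hWV, smul_one_eq_diagonal, diagonal_sub]
  have hdet : W.det * V.det = 1 := by rw [← det_mul, hWV, det_one]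
  rw [← det_diagonal, ← hconj, det_mul, det_mul, mul_right_comm, hdet, one_mul]

end Krylov

/-- For a matrix `A` with pairwise distinct eigenvalues, a biorthogonal system
of right and left eigenvectors, and Krylov matrices `K`, `K'` built from the
iterates of `u₀` under `A` and `Aᴴ`, the generalized secular determinant
factorizes as
`det(K'ᴴ A K − z K'ᴴ K) = (∏_i conj(β_i) α_i) (∏_{i<j} (λ_j − λ_i))² ∏_i (λ_i − z)`;
in particular, when all `α_i` and `β_i` are nonzero, its roots are exactly the
eigenvalues of `A`. -/
theorem krylov_secular_determinant
    (n : ℕ) (A : Matrix (Fin n) (Fin n) ℂ)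
    (r l : Fin n → Fin n → ℂ) (lam : Fin n → ℂ)
    (hdist : ∀ i j : Fin n, i ≠ j → lam i ≠ lam j)
    (hr : ∀ i, A.mulVec (r i) = lam i • r i)
    (hl : ∀ i, Aᴴ.mulVec (l i) = (starRingEnd ℂ (lam i)) • l i)
    (horth : ∀ i j, star (l i) ⬝ᵥ r j = if i = j then 1 else 0)
    (u₀ : Fin n → ℂ) (α β : Fin n → ℂ)
    (hα : ∀ i, α i = star (l i) ⬝ᵥ u₀) (hβ : ∀ i, β i = star (r i) ⬝ᵥ u₀)
    (K K' : Matrix (Fin n) (Fin n) ℂ)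
    (hK : K = Matrix.of fun i j : Fin n => ((A ^ (j : ℕ)).mulVec u₀) i)
    (hK' : K' = Matrix.of fun i j : Fin n => ((Aᴴ ^ (j : ℕ)).mulVec u₀) i) :
    (∀ z : ℂ,
        (K'ᴴ * A * K - z • (K'ᴴ * K)).det =
          (∏ i, starRingEnd ℂ (β i) * α i) *
            (∏ i, ∏ j ∈ Finset.Ioi i, (lam j - lam i)) ^ 2 *
            ∏ i, (lam i - z)) ∧
      ((∀ i, α i ≠ 0) → (∀ i, β i ≠ 0) →
        ∀ z : ℂ, (K'ᴴ * A * K - z • (K'ᴴ * K)).det = 0 ↔ ∃ i, lam i = z) := by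
  have hL : ∀ i, star (l i) ᵥ* A = lam i • star (l i) := fun i => by
    have := congrArg star (hl i)
    rwa [star_mulVec, conjTranspose_conjTranspose, star_smul, starRingEnd_apply, star_star] at this
  have hR : ∀ i, star (r i) ᵥ* Aᴴ = starRingEnd ℂ (lam i) • star (r i) := fun i => by
    rw [← star_mulVec, hr i, star_smul, starRingEnd_apply]
  set L : Matrix (Fin n) (Fin n) ℂ := of fun i => star (l i) with hLdef
  set S : Matrix (Fin n) (Fin n) ℂ := of fun i => star (r i) with hSdef
  have hLS : L * Sᴴ = 1 := by
    ext i j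
    have : (L * Sᴴ) i j = star (l i) ⬝ᵥ r j := by
      simp [hLdef, hSdef, Matrix.mul_apply, dotProduct]
    rw [this, horth, one_apply]
  have hdet : L.det * star S.det = 1 := by
    rw [← det_conjTranspose, ← det_mul, hLS, det_one]
  have hdetK : L.det * K.det = (∏ i, α i) * (vandermonde lam).det := by
    rw [hK, det_leftEigenvectors_mul_det_krylov (W := L) hL]
    simp_rw [hα]
    rfl
  have hdetK' : star S.det * K'ᴴ.det =
      (∏ i, starRingEnd ℂ (β i)) * (vandermonde lam).det := by
    have h := det_leftEigenvectors_mul_det_krylov (W := S) hR u₀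
    rw [← hK'] at h
    have hprod : ∏ i, S i ⬝ᵥ u₀ = ∏ i, β i := by
      simp_rw [hβ]
      rfl
    rw [det_conjTranspose, ← star_mul', h, hprod, det_vandermonde, det_vandermonde]
    simp
  have key : ∀ z : ℂ,
      (K'ᴴ * A * K - z • (K'ᴴ * K)).det =
        (∏ i, starRingEnd ℂ (β i) * α i) *
          (∏ i, ∏ j ∈ Finset.Ioi i, (lam j - lam i)) ^ 2 * ∏ i, (lam i - z) := by
    intro z
    have hfac : K'ᴴ * A * K - z • (K'ᴴ * K) =
        K'ᴴ * (A - z • (1 : Matrix (Fin n) (Fin n) ℂ)) * K := by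
      simp [mul_sub, sub_mul]
    rw [hfac, det_mul, det_mul, det_sub_smul_one_of_leftEigenvectors (W := L) hL hLS z,
      ← det_vandermonde, Finset.prod_mul_distrib]
    linear_combination (∏ i, (lam i - z)) *
      (-K'ᴴ.det * K.det * hdet + L.det * K.det * hdetK' +
        (∏ i, starRingEnd ℂ (β i)) * (vandermonde lam).det * hdetK)
  refine ⟨key, fun hα0 hβ0 z => ?_⟩
  have hvand : (∏ i, ∏ j ∈ Finset.Ioi i, (lam j - lam i)) ≠ 0 := by
    rw [← det_vandermonde, det_vandermonde_ne_zero_iff]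
    exact fun i j hij => by_contra fun hne => hdist i j hne hij
  have hcoef : (∏ i, starRingEnd ℂ (β i) * α i) ≠ 0 :=
    Finset.prod_ne_zero_iff.2 fun i _ =>
      mul_ne_zero ((map_ne_zero (starRingEnd ℂ)).2 (hβ0 i)) (hα0 i)
  rw [key, mul_eq_zero_iff_left (mul_ne_zero hcoef (pow_ne_zero 2 hvand)),
    Finset.prod_eq_zero_iff]
  simp [sub_eq_zero]
end
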